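/- arXiv:1403.3042 — 2 statements merged into one kernel-verified Lean document; each statement's English description precedes it below -/
import Mathlib

section
/- Let K be the category whose objects are the sets which are either one-element or infinite, and whose morphisms are the injective maps. Then K has filtered colimits, a one-element set is a finitely presentable object of K and forms a strong generator of K, but K is not finitely accessible. -/
open CategoryTheory CategoryTheory.Limits

universe w v u

namespace PaperAcc

/-- A category `J` is `κ`-filtered if every diagram indexed by a category with fewer than `κ`
arrows admits a cocone. -/
def IsCardinalFiltered (J : Type v) [Category.{v} J] (κ : Cardinal.{v}) : Prop :=
  ∀ (A : Type v) [SmallCategory A], Cardinal.mk (Arrow A) < κ →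
    ∀ F : A ⥤ J, Nonempty (Cocone F)

/-- A preorder `P` is `κ`-directed if every subset of cardinality `< κ` has an upper bound. -/
def IsCardinalDirected (P : Type v) [Preorder P] (κ : Cardinal.{v}) : Prop :=
  ∀ S : Set P, Cardinal.mk S < κ → ∃ p : P, ∀ s ∈ S, s ≤ p

/-- An object `X` is `κ`-presentable if `Hom(X, -)` preserves `κ`-filtered colimits. -/
def IsPresentable {M : Type u} [Category.{v} M] (κ : Cardinal.{v}) (X : M) : Prop :=
  ∀ (J : Type v) [SmallCategory J], IsCardinalFiltered J κ →
    Nonempty (PreservesColimitsOfShape J (coyoneda.obj (Opposite.op X)))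

/-- A presentation of `X` as a `κ`-filtered colimit of objects belonging to `P`. -/
structure FilteredColimitPresentation {M : Type u} [Category.{v} M] (κ : Cardinal.{v})
    (P : Set M) (X : M) where
  J : Type v
  [instJ : SmallCategory J]
  filtered : IsCardinalFiltered J κ
  F : J ⥤ M
  mem : ∀ j, F.obj j ∈ P
  c : Cocone F
  isColimit : IsColimit c
  iso : c.pt ≅ X

/-- A presentation of `X` as a `κ`-directed colimit of objects belonging to `P`. -/
structure DirectedColimitPresentation {M : Type u} [Category.{v} M] (κ : Cardinal.{v})
    (P : Set M) (X : M) where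
  J : Type v
  [instJ : Preorder J]
  directed : IsCardinalDirected J κ
  F : J ⥤ M
  mem : ∀ j, F.obj j ∈ P
  c : Cocone F
  isColimit : IsColimit c
  iso : c.pt ≅ X

/-- A class of arrows (viewed as a full subcategory of the arrow category) is closed under
`κ`-filtered colimits. -/
def ClosedUnderFilteredColimits {M : Type u} [Category.{v} M] (κ : Cardinal.{v})
    (P : Set (Arrow M)) : Prop :=
  ∀ (J : Type v) [SmallCategory J], IsCardinalFiltered J κ →
    ∀ (F : J ⥤ Arrow M) (c : Cocone F), IsColimit c → (∀ j, F.obj j ∈ P) → c.pt ∈ P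

/-- The morphisms having the right lifting property with respect to every member of the
family `f`. -/
def RlpOf {M : Type u} [Category.{v} M] {ι : Type w} {A B : ι → M}
    (f : ∀ i, A i ⟶ B i) : MorphismProperty M :=
  fun _ _ g => ∀ i, HasLiftingProperty (f i) g

/-- The morphisms having the left lifting property with respect to every morphism in `P`. -/
def Llp {M : Type u} [Category.{v} M] (P : MorphismProperty M) : MorphismProperty M :=
  fun _ _ g => ∀ ⦃X Y : M⦄ (p : X ⟶ Y), P p → HasLiftingProperty g p

/-- The class `C` is cofibrantly generated by a set of morphisms between `κ`-presentable
objects: `C = llp(rlp(I))` for such a set `I`. -/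
def CofibrantlyGeneratedByPresentables {M : Type u} [Category.{v} M] (κ : Cardinal.{v})
    (C : MorphismProperty M) : Prop :=
  ∃ (ι : Type v) (A B : ι → M) (f : ∀ i, A i ⟶ B i),
    (∀ i, IsPresentable κ (A i)) ∧ (∀ i, IsPresentable κ (B i)) ∧
      C = Llp (RlpOf f)

/-- A category is locally `κ`-presentable: it is cocomplete and has a set of `κ`-presentable
objects such that every object is a `κ`-filtered colimit of objects from this set. -/
def IsLocallyPresentable (M : Type u) [Category.{v} M] (κ : Cardinal.{v}) : Prop :=
  HasColimits M ∧
    ∃ (ι : Type v) (G : ι → M), (∀ i, IsPresentable κ (G i)) ∧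
      ∀ X : M, Nonempty (FilteredColimitPresentation κ (Set.range G) X)

/-- A class of morphisms is stable under retracts (in the arrow category). -/
def IsStableUnderRetracts {M : Type u} [Category.{v} M] (P : MorphismProperty M) : Prop :=
  ∀ {X Y X' Y' : M} (f : X ⟶ Y) (g : X' ⟶ Y') (iX : X ⟶ X') (rX : X' ⟶ X)
    (iY : Y ⟶ Y') (rY : Y' ⟶ Y), iX ≫ rX = 𝟙 X → iY ≫ rY = 𝟙 Y →
    iX ≫ g = f ≫ iY → rX ≫ f = g ≫ rY → P g → P f

/-- A model structure on a category: classes of weak equivalences, cofibrations and fibrations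
satisfying the axioms of a (closed) model category. -/
structure ModelStructure (M : Type u) [Category.{v} M] where
  W : MorphismProperty M
  Cof : MorphismProperty M
  Fib : MorphismProperty M
  W_id : ∀ X : M, W (𝟙 X)
  W_comp : ∀ {X Y Z : M} (f : X ⟶ Y) (g : Y ⟶ Z), W f → W g → W (f ≫ g)
  W_of_comp_right : ∀ {X Y Z : M} (f : X ⟶ Y) (g : Y ⟶ Z), W g → W (f ≫ g) → W f
  W_of_comp_left : ∀ {X Y Z : M} (f : X ⟶ Y) (g : Y ⟶ Z), W f → W (f ≫ g) → W g
  W_retract : IsStableUnderRetracts W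
  Cof_retract : IsStableUnderRetracts Cof
  Fib_retract : IsStableUnderRetracts Fib
  lift_trivCof_fib : ∀ {A B X Y : M} (i : A ⟶ B) (p : X ⟶ Y),
    Cof i → W i → Fib p → HasLiftingProperty i p
  lift_cof_trivFib : ∀ {A B X Y : M} (i : A ⟶ B) (p : X ⟶ Y),
    Cof i → Fib p → W p → HasLiftingProperty i p
  fact_cof_trivFib : ∀ {X Y : M} (f : X ⟶ Y),
    ∃ (Z : M) (i : X ⟶ Z) (p : Z ⟶ Y), Cof i ∧ Fib p ∧ W p ∧ i ≫ p = f
  fact_trivCof_fib : ∀ {X Y : M} (f : X ⟶ Y),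
    ∃ (Z : M) (i : X ⟶ Z) (p : Z ⟶ Y), Cof i ∧ W i ∧ Fib p ∧ i ≫ p = f

/-- A model structure is `κ`-combinatorial if the underlying category is locally
`κ`-presentable and both cofibrations and trivial cofibrations are cofibrantly generated
by sets of morphisms between `κ`-presentable objects. -/
structure IsCombinatorial {M : Type u} [Category.{v} M] (S : ModelStructure M)
    (κ : Cardinal.{v}) : Prop where
  isRegular : κ.IsRegular
  locallyPresentable : IsLocallyPresentable M κ
  cofGenerated : CofibrantlyGeneratedByPresentables κ S.Cof
  trivCofGenerated : CofibrantlyGeneratedByPresentables κ (S.Cof ⊓ S.W)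

/-- An object is cofibrant if the morphism from an(y) initial object to it is a cofibration. -/
def Cofibrant {M : Type u} [Category.{v} M] (S : ModelStructure M) (X : M) : Prop :=
  ∀ ⦃O : M⦄, IsInitial O → ∀ f : O ⟶ X, S.Cof f

/-- A cylinder object for `X`: a factorization `X ⊔ X → C → X` of the codiagonal into
a cofibration followed by a weak equivalence. -/
structure CylinderObject {M : Type u} [Category.{v} M] (S : ModelStructure M) (X : M) where
  C : M
  i₀ : X ⟶ C
  i₁ : X ⟶ C
  p : C ⟶ X
  hi₀ : i₀ ≫ p = 𝟙 X
  hi₁ : i₁ ≫ p = 𝟙 X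
  hp : S.W p
  hcof : ∀ (c : BinaryCofan X X) (hc : IsColimit c), S.Cof (hc.desc (BinaryCofan.mk i₀ i₁))

/-- A commutative square on `(f, g, h, k)` (with `f : A ⟶ B`, `g : A ⟶ X`, `h : B ⟶ Y`,
`k : X ⟶ Y`) is a homotopy pushout: for some (equivalently, any) replacement of the span
`B ← A → X` by a span of cofibrations between cofibrant objects which is weakly equivalent
to it, the comparison morphism from the (strict) pushout of the replacement to `Y` is a
weak equivalence. -/
def IsHomotopyPushout {M : Type u} [Category.{v} M] (S : ModelStructure M)
    {A B X Y : M} (f : A ⟶ B) (g : A ⟶ X) (h : B ⟶ Y) (k : X ⟶ Y) : Prop :=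
  ∃ (A' B' X' P : M) (wA : A' ⟶ A) (i : A' ⟶ B') (wB : B' ⟶ B)
    (j : A' ⟶ X') (wX : X' ⟶ X) (pB : B' ⟶ P) (pX : X' ⟶ P) (m : P ⟶ Y),
      Cofibrant S A' ∧ S.W wA ∧ S.Cof i ∧ S.W wB ∧ S.Cof j ∧ S.W wX ∧
      i ≫ wB = wA ≫ f ∧ j ≫ wX = wA ≫ g ∧
      IsPushout i j pB pX ∧ pB ≫ m = wB ≫ h ∧ pX ≫ m = wX ≫ k ∧ S.W m

/-- A morphism `i : A ⟶ B` is a formal cofibration if every pushout square of `i` along a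
morphism `f : A ⟶ X` with `X` cofibrant is a homotopy pushout. -/
def IsFormalCofibration {M : Type u} [Category.{v} M] (S : ModelStructure M)
    {A B : M} (i : A ⟶ B) : Prop :=
  ∀ {X Y : M} (f : A ⟶ X) (g : B ⟶ Y) (k : X ⟶ Y),
    Cofibrant S X → IsPushout i f g k → IsHomotopyPushout S i f g k

/-- The set of arrows satisfying `P` whose domain and codomain are `κ`-presentable. -/
def PresentableArrowsIn {M : Type u} [Category.{v} M] (κ : Cardinal.{v})
    (P : Set (Arrow M)) : Set (Arrow M) :=
  {a | a ∈ P ∧ IsPresentable κ a.left ∧ IsPresentable κ a.right}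

end PaperAcc

namespace PaperAcc

/-- A set of objects is a strong generator: the corresponding hom-functors are jointly
faithful and jointly conservative. -/
def IsStrongGenerator {C : Type w} [Category.{v} C] (G : Set C) : Prop :=
  (∀ {X Y : C} (f g : X ⟶ Y), (∀ S ∈ G, ∀ h : S ⟶ X, h ≫ f = h ≫ g) → f = g) ∧
  (∀ {X Y : C} (f : X ⟶ Y),
    (∀ S ∈ G, Function.Bijective (fun h : S ⟶ X => h ≫ f)) → IsIso f)

/-- A category is `κ`-accessible: it has `κ`-filtered colimits and a set of `κ`-presentable
objects such that every object is a `κ`-filtered colimit of objects from this set. -/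
def IsAccessibleCategory (C : Type w) [Category.{v} C] (κ : Cardinal.{v}) : Prop :=
  (∀ (J : Type v) [SmallCategory J], IsCardinalFiltered J κ → HasColimitsOfShape J C) ∧
  ∃ (ι : Type v) (G : ι → C), (∀ i, IsPresentable κ (G i)) ∧
    ∀ X : C, Nonempty (FilteredColimitPresentation κ (Set.range G) X)

/-- The category whose objects are the sets (types) which are either one-element or infinite
and whose morphisms are the injective maps. -/
def SetsCat : Type (u + 1) :=
  {α : Type u // (Nonempty α ∧ Subsingleton α) ∨ Infinite α}

instance : Category.{u} SetsCat.{u} where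
  Hom A B := {f : A.1 → B.1 // Function.Injective f}
  id A := ⟨id, fun _ _ h => h⟩
  comp f g := ⟨g.1 ∘ f.1, g.2.comp f.2⟩
  id_comp f := Subtype.ext rfl
  comp_id f := Subtype.ext rfl
  assoc f g h := Subtype.ext rfl

theorem isCardinalFiltered_aleph0_iff (J : Type u) [SmallCategory J] :
    IsCardinalFiltered J Cardinal.aleph0 ↔ IsFiltered J := by
  constructor
  · intro h
    refine IsFiltered.of_cocone_nonempty.{u} J fun {A} _ _ F => h A ?_ F
    rw [Cardinal.lt_aleph0_iff_finite]
    exact Finite.of_injective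
      (fun a : Arrow A => (⟨a.left, a.right, a.hom⟩ : Σ x y : A, x ⟶ y))
      (by rintro ⟨x, y, f⟩ ⟨x', y', f'⟩ h; cases h; rfl)
  · intro _ A _ hA F
    rw [Cardinal.lt_aleph0_iff_finite] at hA
    have : Finite A := Finite.of_injective (fun x : A => Arrow.mk (𝟙 x)) fun x y h =>
      congrArg (fun a : Arrow A => a.left) h
    have hHom (x y : A) : Finite (x ⟶ y) :=
      Finite.of_injective (fun f : x ⟶ y => Arrow.mk f) (Arrow.mk_injective x y)
    have : FinCategory A :=
      { fintypeObj := Fintype.ofFinite A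
        fintypeHom := fun x y => Fintype.ofFinite (x ⟶ y) }
    exact IsFiltered.cocone_nonempty F

namespace SetsCat

/-- The underlying-set functor. -/
def forget : SetsCat.{u} ⥤ Type u where
  obj A := A.1
  map f := ↾f.1

section FilteredColimits

variable {J : Type u} [SmallCategory J] {F : J ⥤ SetsCat.{u}}

/-- A cocone is jointly surjective if its legs cover its vertex. -/
def JointlySurjective (c : Cocone F) : Prop :=
  ∀ x : c.pt.1, ∃ j, ∃ y : (F.obj j).1, (c.ι.app j).1 y = x

theorem cocone_map_apply (c : Cocone F) {i j : J} (f : i ⟶ j) (x : (F.obj i).1) :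
    (c.ι.app j).1 ((F.map f).1 x) = (c.ι.app i).1 x :=
  congrFun (congrArg Subtype.val (c.w f)) x

variable [IsFiltered J]

theorem cocone_eq_iff (c : Cocone F) {i j : J} (x : (F.obj i).1) (y : (F.obj j).1) :
    (c.ι.app i).1 x = (c.ι.app j).1 y ↔
      (F.map (IsFiltered.leftToMax i j)).1 x = (F.map (IsFiltered.rightToMax i j)).1 y := by
  rw [← (c.ι.app (IsFiltered.max i j)).2.eq_iff, cocone_map_apply, cocone_map_apply]

/-- Jointly surjective cocones over filtered diagrams are colimit cocones. -/
noncomputable def JointlySurjective.isColimit {c : Cocone F} (hc : JointlySurjective c) :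
    IsColimit c := by
  choose i y hy using hc
  have key (s : Cocone F) (x : c.pt.1) (j : J) (z : (F.obj j).1) (hz : (c.ι.app j).1 z = x) :
      (s.ι.app (i x)).1 (y x) = (s.ι.app j).1 z := by
    rw [cocone_eq_iff, ← cocone_eq_iff c, hy, hz]
  exact
    { desc s := ⟨fun x => (s.ι.app (i x)).1 (y x), fun x x' h => by
        rw [← hy x, ← hy x', cocone_eq_iff, ← cocone_eq_iff s]
        exact h⟩
      fac s j := Subtype.ext (funext fun z => key s _ j z rfl)
      uniq s m hm := Subtype.ext (funext fun x => by
        have := congrFun (congrArg Subtype.val (hm (i x))) (y x)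
        rw [← this]
        exact congrArg m.1 (hy x).symm) }

variable (F)

theorem exists_jointlySurjective_cocone : ∃ c : Cocone F, JointlySurjective c := by
  let G : J ⥤ Type u := F ⋙ forget
  have hinj (j : J) : Function.Injective (colimit.ι G j : (F.obj j).1 → colimit G) := by
    intro x y hxy
    obtain ⟨k, f, g, h⟩ := (Types.FilteredColimit.colimit_eq_iff G).1 hxy
    have hfg : F.map f ≫ F.map (IsFiltered.coeqHom f g) =
        F.map g ≫ F.map (IsFiltered.coeqHom f g) := by
      rw [← F.map_comp, ← F.map_comp, IsFiltered.coeq_condition]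
    apply (F.map f ≫ F.map (IsFiltered.coeqHom f g)).2
    trans (F.map g ≫ F.map (IsFiltered.coeqHom f g)).1 y
    · exact congrArg (F.map (IsFiltered.coeqHom f g)).1 h
    · rw [hfg]
  have hpt : (Nonempty (colimit G) ∧ Subsingleton (colimit G)) ∨ Infinite (colimit G) := by
    by_cases h : ∃ j, Infinite (F.obj j).1
    · obtain ⟨j, hj⟩ := h
      exact Or.inr (@Infinite.of_injective _ _ hj _ (hinj j))
    · have hF (j : J) := (F.obj j).2.resolve_right fun hj => h ⟨j, hj⟩
      refine Or.inl ⟨?_, ⟨fun a b => ?_⟩⟩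
      · obtain ⟨j⟩ := IsFiltered.nonempty (C := J)
        obtain ⟨x⟩ := (hF j).1
        exact ⟨colimit.ι G j x⟩
      · obtain ⟨i, x, rfl⟩ := Types.jointly_surjective' a
        obtain ⟨j, y, rfl⟩ := Types.jointly_surjective' b
        exact (Types.FilteredColimit.colimit_eq_iff G).2
          ⟨IsFiltered.max i j, IsFiltered.leftToMax i j, IsFiltered.rightToMax i j,
            (hF _).2.elim _ _⟩
  exact ⟨{ pt := ⟨colimit G, hpt⟩
           ι := { app := fun j => ⟨colimit.ι G j, hinj j⟩
                  naturality := fun i j f => Subtype.ext (funext fun x =>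
                    ConcreteCategory.congr_hom (colimit.w G f) x) } },
    fun x => Types.jointly_surjective' x⟩

theorem hasColimitsOfShape_of_isFiltered : HasColimitsOfShape J SetsCat.{u} where
  has_colimit F :=
    let ⟨c, hc⟩ := exists_jointlySurjective_cocone F
    ⟨⟨c, hc.isColimit⟩⟩

variable {F}

theorem jointlySurjective_of_isColimit {c : Cocone F} (hc : IsColimit c) :
    JointlySurjective c := by
  obtain ⟨d, hd⟩ := exists_jointlySurjective_cocone F
  intro x
  obtain ⟨j, y, hy⟩ := hd ((hc.desc d).1 x)
  refine ⟨j, y, (hc.desc d).2 ?_⟩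
  rw [← hy]
  exact congrFun (congrArg Subtype.val (hc.fac d j)) y

end FilteredColimits

/-- The morphism from a one-element set picking out an element. -/
def point (X : SetsCat.{u}) [Subsingleton X.1] {A : SetsCat.{u}} (a : A.1) : X ⟶ A :=
  ⟨fun _ => a, fun _ _ _ => Subsingleton.elim _ _⟩

theorem isPresentable_of_subsingleton (X : SetsCat.{u}) [Nonempty X.1] [Subsingleton X.1] :
    IsPresentable Cardinal.aleph0 X := by
  intro J _ hJ
  have : IsFiltered J := (isCardinalFiltered_aleph0_iff J).1 hJ
  let x₀ : X.1 := Classical.arbitrary _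
  refine ⟨⟨fun {F} => ⟨fun {c} hc => ⟨Types.FilteredColimit.isColimitOf _ _ ?_ ?_⟩⟩⟩⟩
  · intro (f : X ⟶ c.pt)
    obtain ⟨j, y, hy⟩ := jointlySurjective_of_isColimit hc (f.1 x₀)
    refine ⟨j, point X y, Subtype.ext (funext fun x => ?_)⟩
    rw [Subsingleton.elim x x₀]
    exact hy.symm
  · intro i j (f : X ⟶ F.obj i) (g : X ⟶ F.obj j) h
    refine ⟨IsFiltered.max i j, IsFiltered.leftToMax i j, IsFiltered.rightToMax i j,
      Subtype.ext (funext fun x => ?_)⟩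
    exact (cocone_eq_iff c (f.1 x) (g.1 x)).1
      (congrFun (congrArg Subtype.val (show f ≫ c.ι.app i = g ≫ c.ι.app j from h)) x)

theorem isIso_of_surjective {A B : SetsCat.{u}} (f : A ⟶ B) (hf : Function.Surjective f.1) :
    IsIso f :=
  ⟨⟨Function.surjInv hf, Function.injective_surjInv hf⟩,
    Subtype.ext (funext (Function.leftInverse_surjInv ⟨f.2, hf⟩)),
    Subtype.ext (funext (Function.rightInverse_surjInv hf))⟩

theorem isStrongGenerator_of_subsingleton (X : SetsCat.{u}) [Nonempty X.1] [Subsingleton X.1] :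
    IsStrongGenerator {X} := by
  let x₀ : X.1 := Classical.arbitrary _
  refine ⟨fun f g h => Subtype.ext (funext fun a => ?_), fun f h => ?_⟩
  · exact congrFun (congrArg Subtype.val (h X rfl (point X a))) x₀
  · refine isIso_of_surjective f fun b => ?_
    obtain ⟨g, hg⟩ := (h X rfl).2 (point X b)
    exact ⟨g.1 x₀, congrFun (congrArg Subtype.val hg) x₀⟩

section InfiniteSets

variable {α : Type u} (e : ℕ ↪ α)

/-- The complement of the points `e (2 * m)` with `n ≤ m`. -/
def evenTailCompl (n : ℕ) : Set α :=
  {x | ∀ m, n ≤ m → x ≠ e (2 * m)}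

theorem infinite_evenTailCompl (n : ℕ) : Infinite (evenTailCompl e n) :=
  Infinite.of_injective
    (fun k : ℕ => (⟨e (2 * k + 1), fun m _ h => by
      have := e.injective h
      omega⟩ : evenTailCompl e n))
    fun k l h => by
      have := e.injective (congrArg Subtype.val h)
      omega

theorem exists_mem_evenTailCompl (x : α) : ∃ n, x ∈ evenTailCompl e n := by
  by_cases h : ∃ m, x = e (2 * m)
  · obtain ⟨m, rfl⟩ := h
    refine ⟨m + 1, fun k hk h => ?_⟩
    have := e.injective h
    omega
  · exact ⟨0, fun m _ hm => h ⟨m, hm⟩⟩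

/-- The increasing sequence of the infinite sets `evenTailCompl e n`. -/
def evenTailComplFunctor : ULift.{u} ℕ ⥤ SetsCat.{u} where
  obj n := ⟨evenTailCompl e n.down, Or.inr (infinite_evenTailCompl e n.down)⟩
  map {n _} f := ⟨fun x => ⟨x.1, fun m hm => x.2 m (le_trans (ULift.down_le.2 (leOfHom f)) hm)⟩,
    fun _ _ h => Subtype.ext (congrArg (fun z => z.1) h)⟩

variable [Infinite α]

/-- The cocone of inclusions of the sets `evenTailCompl e n`. -/
def evenTailComplCocone : Cocone (evenTailComplFunctor e) where
  pt := ⟨α, Or.inr ‹_›⟩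
  ι := { app := fun _ => ⟨Subtype.val, Subtype.val_injective⟩ }

theorem jointlySurjective_evenTailComplCocone : JointlySurjective (evenTailComplCocone e) :=
  fun x => let ⟨n, hn⟩ := exists_mem_evenTailCompl e x; ⟨⟨n⟩, ⟨x, hn⟩, rfl⟩

end InfiniteSets

theorem not_isPresentable_of_infinite (X : SetsCat.{u}) [Infinite X.1] :
    ¬ IsPresentable Cardinal.aleph0 X := by
  intro h
  let e : ℕ ↪ X.1 := Infinite.natEmbedding X.1
  obtain ⟨_⟩ := h (ULift.{u} ℕ) ((isCardinalFiltered_aleph0_iff _).2 inferInstance)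
  obtain ⟨n, (f : X ⟶ (evenTailComplFunctor e).obj n), hf⟩ :=
    Types.jointly_surjective_of_isColimit
      (isColimitOfPreserves (coyoneda.obj (Opposite.op X))
        (jointlySurjective_evenTailComplCocone e).isColimit) (𝟙 X)
  exact (f.1 (e (2 * n.down))).2 n.down le_rfl
    (congrFun (congrArg Subtype.val (show f ≫ (evenTailComplCocone e).ι.app n = 𝟙 X from hf)) _)

theorem not_isAccessibleCategory : ¬ IsAccessibleCategory SetsCat.{u} Cardinal.aleph0 := by
  rintro ⟨-, ι, G, hG, hpres⟩
  obtain ⟨P⟩ := hpres ⟨ULift.{u} ℕ, Or.inr inferInstance⟩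
  let _ := P.instJ
  have : IsFiltered P.J := (isCardinalFiltered_aleph0_iff P.J).1 P.filtered
  have hF (j : P.J) : Subsingleton (P.F.obj j).1 := by
    obtain ⟨i, hi⟩ := P.mem j
    rw [← hi]
    exact ((G i).2.resolve_right fun _ => not_isPresentable_of_infinite (G i) (hG i)).2
  have hpt : Subsingleton P.c.pt.1 := ⟨fun a b => by
    obtain ⟨i, x, rfl⟩ := jointlySurjective_of_isColimit P.isColimit a
    obtain ⟨j, y, rfl⟩ := jointlySurjective_of_isColimit P.isColimit b
    exact (cocone_eq_iff P.c x y).2 (Subsingleton.elim _ _)⟩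
  have := P.iso.inv.2 (Subsingleton.elim (P.iso.inv.1 ⟨0⟩) (P.iso.inv.1 ⟨1⟩))
  simp at this

end SetsCat

/-- The category `K` of one-element or infinite sets and injective maps has
filtered colimits; every one-element set is a finitely presentable object of `K` and forms a
strong generator of `K`; but `K` is not finitely accessible. -/
theorem statement17 :
    (∀ (J : Type u) [SmallCategory J], IsCardinalFiltered J Cardinal.aleph0 →
      HasColimitsOfShape J SetsCat.{u}) ∧
    (∀ X : SetsCat.{u}, Nonempty X.1 → Subsingleton X.1 →
      IsPresentable Cardinal.aleph0 X ∧ IsStrongGenerator {X}) ∧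
    ¬ IsAccessibleCategory SetsCat.{u} Cardinal.aleph0 := by
  exact ⟨fun J _ hJ =>
      have : IsFiltered J := (isCardinalFiltered_aleph0_iff J).1 hJ
      SetsCat.hasColimitsOfShape_of_isFiltered,
    fun X _ _ => ⟨SetsCat.isPresentable_of_subsingleton X,
      SetsCat.isStrongGenerator_of_subsingleton X⟩,
    SetsCat.not_isAccessibleCategory⟩

end PaperAcc
end

section
/- In the functor category Set^{ω^op} of presheaves on the ordered set of natural numbers ω, the terminal object 1 is not finitely presentable; consequently, equipping Set^{ω^op} with the discrete model structure (in which every morphism is a cofibration and the weak equivalences are the isomorphisms), the terminal object is the unique acyclic object but it is not a directed colimit of finitely presentable acyclic objects, even though the identity morphism of 1 is a directed colimit in the arrow category of weak equivalences between finitely presentable objects. -/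
open CategoryTheory CategoryTheory.Limits

universe w v u

namespace PaperAcc

/-- A `κ`-directed preorder is `κ`-filtered as a category. -/
lemma IsCardinalDirected.isCardinalFiltered {P : Type v} [Preorder P] {κ : Cardinal.{v}}
    (hP : IsCardinalDirected P κ) : IsCardinalFiltered P κ := by
  intro A _ hA F
  have hid : Function.Injective (fun a : A => Arrow.mk (𝟙 a)) := fun _ _ h =>
    congrArg Comma.left h
  obtain ⟨p, hp⟩ := hP (Set.range F.obj)
    ((Cardinal.mk_range_le.trans (Cardinal.mk_le_of_injective hid)).trans_lt hA)
  exact ⟨{ pt := p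
           ι := { app := fun a => homOfLE (hp _ ⟨a, rfl⟩)
                  naturality := fun _ _ _ => Subsingleton.elim _ _ } }⟩

lemma isCardinalDirected_aleph0 (P : Type v) [Preorder P] [Nonempty P]
    [IsDirectedOrder P] : IsCardinalDirected P Cardinal.aleph0 := fun _ hS =>
  (Cardinal.lt_aleph0_iff_set_finite.1 hS).bddAbove

lemma IsCardinalDirected.nonempty {P : Type v} [Preorder P]
    (hP : IsCardinalDirected P Cardinal.aleph0) : Nonempty P :=
  let ⟨p, _⟩ := hP ∅ (Cardinal.lt_aleph0_iff_set_finite.2 Set.finite_empty)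
  ⟨p⟩

lemma IsPresentable.of_iso {M : Type u} [Category.{v} M] {κ : Cardinal.{v}} {X Y : M}
    (hX : IsPresentable κ X) (e : X ≅ Y) : IsPresentable κ Y := by
  intro J _ hJ
  obtain ⟨_⟩ := hX J hJ
  exact ⟨preservesColimitsOfShape_of_natIso (coyoneda.mapIso e.symm.op)⟩

/-- Representable presheaves are `κ`-presentable for every `κ`. -/
lemma isPresentable_uliftYoneda_obj {C : Type} [SmallCategory C] (κ : Cardinal.{u}) (X : C) :
    IsPresentable κ (uliftYoneda.{u}.obj X : Cᵒᵖ ⥤ Type u) := by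
  intro J _ _
  let e : (evaluation Cᵒᵖ (Type u)).obj (Opposite.op X) ≅
      coyoneda.obj (Opposite.op (uliftYoneda.{u}.obj X)) :=
    NatIso.ofComponents (fun F => (uliftYonedaEquiv.{u} (F := F)).symm.toIso)
      (fun f => by ext x; exact (uliftYonedaEquiv_symm_comp x f).symm)
  exact ⟨preservesColimitsOfShape_of_natIso e⟩

/-- The chain of representable presheaves on `ℕ`. -/
def representableChain : ULift.{u} ℕ ⥤ ℕᵒᵖ ⥤ Type u :=
  Monotone.functor (f := ULift.down) (fun _ _ h => h) ⋙ uliftYoneda.{u}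

lemma subsingleton_obj_of_isTerminal {C : Type} [SmallCategory C] {T : C ⥤ Type u}
    (hT : IsTerminal T) (k : C) : Subsingleton (T.obj k) :=
  let h := Types.isTerminalEquivUnique _ (hT.isTerminalObj ((evaluation C (Type u)).obj k))
  ⟨fun x y => (h.uniq x).trans (h.uniq y).symm⟩

/-- The cocone from the chain of representables to a terminal presheaf. -/
def representableChainCocone {T : ℕᵒᵖ ⥤ Type u} (hT : IsTerminal T) :
    Cocone representableChain.{u} where
  pt := T
  ι := { app := fun _ => hT.from _
         naturality := fun _ _ _ => hT.hom_ext _ _ }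

/-- The terminal presheaf on `ℕ` is the colimit of the chain of representables. -/
def isColimitRepresentableChainCocone {T : ℕᵒᵖ ⥤ Type u} (hT : IsTerminal T) :
    IsColimit (representableChainCocone hT) where
  desc s :=
    { app := fun k => TypeCat.ofHom fun _ => uliftYonedaEquiv.{u} (s.ι.app ⟨k.unop⟩)
      naturality := fun k l f => by
        ext x
        have h := s.w (homOfLE (ULift.down_le.1 (leOfHom f.unop)) :
          (⟨l.unop⟩ : ULift.{u} ℕ) ⟶ ⟨k.unop⟩)
        have h' := uliftYonedaEquiv_naturality.{u} (s.ι.app ⟨k.unop⟩) f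
        exact (congrArg uliftYonedaEquiv.{u} h).symm.trans h'.symm }
  fac s j := by
    apply uliftYonedaEquiv.{u}.injective
    rfl
  uniq s m hm := by
    ext k x
    have := subsingleton_obj_of_isTerminal hT k
    have h := congrArg uliftYonedaEquiv.{u} (hm ⟨k.unop⟩)
    exact (congrArg (m.app k) (this.elim _ _)).trans h

/-- The terminal presheaf on `ℕ` does not map to any representable one. -/
lemma isEmpty_hom_representableChain {T : ℕᵒᵖ ⥤ Type u} (hT : IsTerminal T)
    (j : ULift.{u} ℕ) : IsEmpty (T ⟶ representableChain.{u}.obj j) := by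
  refine ⟨fun f => ?_⟩
  let x : T.obj (Opposite.op (j.down + 1)) :=
    uliftYonedaEquiv.{u} (hT.from (uliftYoneda.{u}.obj (j.down + 1)))
  let y : ULift.{u} (j.down + 1 ⟶ j.down) := f.app _ x
  exact absurd (leOfHom y.down) (Nat.not_succ_le_self _)

lemma not_isPresentable_of_isTerminal {T : ℕᵒᵖ ⥤ Type u} (hT : IsTerminal T) :
    ¬ IsPresentable Cardinal.aleph0 T := by
  intro h
  obtain ⟨_⟩ := h (ULift.{u} ℕ) (isCardinalDirected_aleph0 _).isCardinalFiltered
  obtain ⟨j, f, -⟩ := Types.jointly_surjective_of_isColimit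
    (isColimitOfPreserves (coyoneda.obj (Opposite.op T)) (isColimitRepresentableChainCocone hT))
    (𝟙 T)
  exact (isEmpty_hom_representableChain hT j).false f

/-- The functor sending an object to its identity arrow. -/
def idArrow (M : Type u) [Category.{v} M] : M ⥤ Arrow M where
  obj X := Arrow.mk (𝟙 X)
  map f := Arrow.homMk f f

/-- The functor sending an object to its identity arrow preserves colimit cocones. -/
def isColimitMapCoconeIdArrow {M : Type u} [Category.{v} M] {J : Type w} [Category J]
    {F : J ⥤ M} {c : Cocone F} (hc : IsColimit c) : IsColimit ((idArrow M).mapCocone c) where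
  desc s := Arrow.homMk (hc.desc (Arrow.leftFunc.mapCocone s))
    (hc.desc (Arrow.rightFunc.mapCocone s)) (hc.hom_ext fun j => by
      have hl : c.ι.app j ≫ hc.desc (Arrow.leftFunc.mapCocone s) = (s.ι.app j).left :=
        hc.fac _ j
      have hr : c.ι.app j ≫ hc.desc (Arrow.rightFunc.mapCocone s) = (s.ι.app j).right :=
        hc.fac _ j
      have hw : (s.ι.app j).left ≫ s.pt.hom = (s.ι.app j).right :=
        (Arrow.w (s.ι.app j)).trans (Category.id_comp _)
      rw [← hl, ← hr] at hw
      exact ((Category.assoc _ _ _).symm.trans hw).trans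
        (congrArg (c.ι.app j ≫ ·) (Category.id_comp _).symm))
  fac s j := by
    ext
    · exact hc.fac (Arrow.leftFunc.mapCocone s) j
    · exact hc.fac (Arrow.rightFunc.mapCocone s) j
  uniq s m hm := by
    ext
    · exact hc.uniq (Arrow.leftFunc.mapCocone s) m.left fun j => congrArg CommaMorphism.left (hm j)
    · exact hc.uniq (Arrow.rightFunc.mapCocone s) m.right
        fun j => congrArg CommaMorphism.right (hm j)

/-- In the category `Set^{ω^op}` of presheaves on the poset `ω` of natural
numbers, the terminal object `1` is not finitely presentable. Consequently, for the discrete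
model structure (every morphism is a cofibration, weak equivalences are the isomorphisms),
`1` is the unique acyclic object, but it is not a directed colimit of finitely presentable
acyclic objects — even though the identity of `1` is a directed colimit in the arrow category
of weak equivalences (= isomorphisms) between finitely presentable objects. -/
theorem statement18 (T : ℕᵒᵖ ⥤ Type u) (hT : IsTerminal T) :
    -- the terminal object is not finitely presentable
    (¬ IsPresentable Cardinal.aleph0 T) ∧
    -- the terminal object is the unique acyclic object
    (IsIso (hT.from T) ∧
      ∀ X : ℕᵒᵖ ⥤ Type u, IsIso (hT.from X) → Nonempty (X ≅ T)) ∧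
    -- `1` is not a directed colimit of finitely presentable acyclic objects
    (¬ Nonempty (DirectedColimitPresentation Cardinal.aleph0
      {X : ℕᵒᵖ ⥤ Type u | IsPresentable Cardinal.aleph0 X ∧ IsIso (hT.from X)} T)) ∧
    -- yet `𝟙 1` is a directed colimit of weak equivalences between finitely presentables
    Nonempty (DirectedColimitPresentation (M := Arrow (ℕᵒᵖ ⥤ Type u)) Cardinal.aleph0
      (PresentableArrowsIn Cardinal.aleph0
        {a : Arrow (ℕᵒᵖ ⥤ Type u) | IsIso a.hom}) (Arrow.mk (𝟙 T))) := by
  refine ⟨not_isPresentable_of_isTerminal hT, ⟨?_, fun X hX => ⟨asIso (hT.from X)⟩⟩, ?_, ?_⟩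
  · rw [hT.hom_ext (hT.from T) (𝟙 T)]
    infer_instance
  · rintro ⟨p⟩
    let := p.instJ
    obtain ⟨j⟩ := p.directed.nonempty
    have hj := p.mem j
    have := hj.2
    exact not_isPresentable_of_isTerminal hT (hj.1.of_iso (asIso (hT.from (p.F.obj j))))
  · exact ⟨{
      J := ULift.{u} ℕ
      directed := isCardinalDirected_aleph0 _
      F := representableChain ⋙ idArrow _
      mem := fun j => ⟨inferInstanceAs (IsIso (𝟙 (representableChain.{u}.obj j))),
        isPresentable_uliftYoneda_obj _ j.down, isPresentable_uliftYoneda_obj _ j.down⟩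
      c := (idArrow _).mapCocone (representableChainCocone hT)
      isColimit := isColimitMapCoconeIdArrow (isColimitRepresentableChainCocone hT)
      iso := Iso.refl _ }⟩

end PaperAcc
end
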